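/- arXiv:1512.07658 — 2 statements merged into one kernel-verified Lean document; each statement's English description precedes it below -/
import Mathlib

section
/- Let A be a finite-dimensional C-algebra and I ⊆ A an ideal. The quotient A/I is a semisimple C-algebra if and only if I contains Rad(A). -/
/-- Data of a linear operad: spaces of `n`-ary operations, an identity operation,
and partial compositions. -/
structure LinearOperadData (F : Type) [Field F] where
  C : ℕ → Type
  one : C 1
  comp : ∀ {m n : ℕ}, C m → C n → Fin m → C (m + n - 1)

/-- An algebra over (the data of) a linear operad: structure maps
`α n : C n → MultilinearMap`, compatible with identity and composition. -/
structure OperadAlgebraOn (F : Type) [Field F] (O : LinearOperadData F)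
    (A : Type) [AddCommGroup A] [Module F A] where
  α : ∀ n, O.C n → MultilinearMap F (fun _ : Fin n => A) A
  α_one : ∀ a : A, α 1 O.one (fun _ => a) = a
  α_comp : ∀ {m n : ℕ} (c : O.C m) (d : O.C n) (i : Fin m) (v : Fin (m + n - 1) → A),
    α (m + n - 1) (O.comp c d i) v =
      α m c (fun k =>
        if hk : (k : ℕ) < (i : ℕ) then v ⟨k, by have := k.isLt; have := i.isLt; omega⟩
        else if hk2 : (k : ℕ) = (i : ℕ) then
          α n d (fun j => v ⟨(i : ℕ) + (j : ℕ), by have := j.isLt; have := i.isLt; omega⟩)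
        else v ⟨(k : ℕ) + n - 1, by have := k.isLt; have := i.isLt; omega⟩)

variable {F : Type} [Field F] {O : LinearOperadData F}
variable {A : Type} [AddCommGroup A] [Module F A]

/-- The partial multiplication operator `a ↦ α n c (v_1,...,a at slot j,...,v_{n-1})`. -/
def OperadAlgebraOn.op (OA : OperadAlgebraOn F O A) {n : ℕ} (c : O.C n)
    (v : Fin n → A) (j : Fin n) : Module.End F A :=
  (OA.α n c).toLinearMap v j

/-- `E_A`: the span of the partial multiplication operators with `n ≥ 2` inputs. -/
def EA (OA : OperadAlgebraOn F O A) : Submodule F (Module.End F A) :=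
  Submodule.span F
    {T | ∃ n : ℕ, 2 ≤ n ∧ ∃ (c : O.C n) (v : Fin n → A) (j : Fin n), T = OA.op c v j}

/-- `L_A`: the image of `C(1)` in `End_F(A)`. -/
def LA (OA : OperadAlgebraOn F O A) : Submodule F (Module.End F A) :=
  Submodule.span F {T | ∃ c : O.C 1, T = OA.op c (fun _ => (0 : A)) 0}

/-- `R_A = L_A + E_A`. -/
def RA (OA : OperadAlgebraOn F O A) : Submodule F (Module.End F A) :=
  LA OA ⊔ EA OA

/-- A subspace `I ⊆ A` is an ideal: closed under all operadic operations whenever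
at least one argument lies in `I`. -/
def IsIdealPred (OA : OperadAlgebraOn F O A) (I : Submodule F A) : Prop :=
  ∀ (n : ℕ) (c : O.C n) (v : Fin n → A) (j : Fin n), v j ∈ I → OA.α n c v ∈ I

/-- A relative ideal `J` of the subalgebra `P ⊆ A`. -/
def IsIdealIn (OA : OperadAlgebraOn F O A) (P J : Submodule F A) : Prop :=
  J ≤ P ∧ ∀ (n : ℕ) (c : O.C n) (v : Fin n → A) (j : Fin n),
    (∀ k, v k ∈ P) → v j ∈ J → OA.α n c v ∈ J

/-- The multiplications (with `n ≥ 2`) of `A` do not all vanish on the subspace `P`. -/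
def HasNonzeroMul (OA : OperadAlgebraOn F O A) (P : Submodule F A) : Prop :=
  ∃ n : ℕ, 2 ≤ n ∧ ∃ (c : O.C n) (v : Fin n → A), (∀ k, v k ∈ P) ∧ OA.α n c v ≠ 0

/-- `P` is a simple summand: an ideal of `A`, with no nontrivial subideals,
on which the multiplication is nonzero. -/
def IsSimplePiece (OA : OperadAlgebraOn F O A) (P : Submodule F A) : Prop :=
  IsIdealPred OA P ∧ (∀ J ≤ P, IsIdealPred OA J → J = ⊥ ∨ J = P) ∧ HasNonzeroMul OA P

/-- `A` is a simple `C`-algebra: the only ideals are `0` and `A`, and `E_A ≠ 0`. -/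
def IsSimpleAlg (OA : OperadAlgebraOn F O A) : Prop :=
  (∀ I : Submodule F A, IsIdealPred OA I → I = ⊥ ∨ I = ⊤) ∧ EA OA ≠ ⊥

/-- `A` is a semisimple `C`-algebra: a finite direct sum of simple `C`-algebras. -/
def IsSemisimpleAlg (OA : OperadAlgebraOn F O A) : Prop :=
  ∃ (m : ℕ) (P : Fin m → Submodule F A),
    iSupIndep P ∧ (⨆ i, P i) = ⊤ ∧ ∀ i, IsSimplePiece OA (P i)

/-- The group of `C`-algebra automorphisms of `A`, as a subgroup of `A ≃ₗ[F] A`. -/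
def AlgAutGroup (OA : OperadAlgebraOn F O A) : Subgroup (A ≃ₗ[F] A) where
  carrier := {f | ∀ (n : ℕ) (c : O.C n) (v : Fin n → A),
    f (OA.α n c v) = OA.α n c (fun k => f (v k))}
  one_mem' := by intro n c v; rfl
  mul_mem' := by
    intro f g hf hg n c v
    show f (g (OA.α n c v)) = _
    rw [hg, hf]
    rfl
  inv_mem' := by
    intro f hf n c v
    have h1 : ∀ x : A, f (f⁻¹ x) = x := fun x => f.apply_symm_apply x
    apply f.injective
    rw [h1, hf]
    simp only [h1]

/-- A maximal (proper) ideal of `A`. -/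
def IsMaxIdeal (OA : OperadAlgebraOn F O A) (M : Submodule F A) : Prop :=
  IsIdealPred OA M ∧ M ≠ ⊤ ∧ ∀ J, IsIdealPred OA J → M < J → J = ⊤

/-- The kernel of the projection to the maximal semisimple quotient of `A`
as an `R_A`-module (the intersection of the maximal ideals). -/
def preRad (OA : OperadAlgebraOn F O A) : Submodule F A :=
  sInf {M | IsMaxIdeal OA M}

/-- The radical of the `C`-algebra `A`: the kernel of `A → Ā`, where `Ā` is the quotient of
the maximal semisimple `R_A`-module quotient `A' = A / preRad` by the kernel of the
`E_A`-action. -/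
def radAlg (OA : OperadAlgebraOn F O A) : Submodule F A :=
  ⨅ (e : Module.End F A) (_ : e ∈ EA OA), (preRad OA).comap e

/-- An operad algebra structure on `A ⧸ I` compatible with the projection. -/
def IsQuotientAlg (OA : OperadAlgebraOn F O A) (I : Submodule F A)
    (OQ : OperadAlgebraOn F O (A ⧸ I)) : Prop :=
  ∀ (n : ℕ) (c : O.C n) (v : Fin n → A),
    I.mkQ (OA.α n c v) = OQ.α n c (fun k => I.mkQ (v k))

/-- A componentwise ("pointwise") operad algebra structure on a product. -/
def IsComponentwiseAlg {ι : Type} {B : ι → Type} [∀ i, AddCommGroup (B i)]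
    [∀ i, Module F (B i)] (OB : ∀ i, OperadAlgebraOn F O (B i))
    (OP : OperadAlgebraOn F O (∀ i, B i)) : Prop :=
  ∀ (n : ℕ) (c : O.C n) (v : Fin n → ∀ i, B i) (i : ι),
    OP.α n c v i = (OB i).α n c (fun k => v k i)

/-- Pointwise algebra structure on `ι → B`. -/
def IsPointwiseAlg {ι B : Type} [AddCommGroup B] [Module F B]
    (OB : OperadAlgebraOn F O B) (OP : OperadAlgebraOn F O (ι → B)) : Prop :=
  ∀ (n : ℕ) (c : O.C n) (v : Fin n → ι → B) (i : ι),
    OP.α n c v i = OB.α n c (fun k => v k i)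

/-- Block-diagonal inclusion `End(B i) → End(Π j, B j)`. -/
def blkMap {ι : Type} [DecidableEq ι] (B : ι → Type) [∀ i, AddCommGroup (B i)]
    [∀ i, Module F (B i)] (i : ι) :
    Module.End F (B i) →ₗ[F] Module.End F (∀ j, B j) where
  toFun T := (LinearMap.single F B i) ∘ₗ T ∘ₗ (LinearMap.proj i)
  map_add' := by
    intro T S
    ext v j
    simp [Pi.single_add]
  map_smul' := by
    intro t T
    ext v j
    simp [Pi.single_smul]

/-- The action of `Perm ι` on `ι → K` by permuting coordinates. -/
def permAct (ι K : Type) [Group K] : Equiv.Perm ι →* MulAut (ι → K) where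
  toFun σ :=
    { toFun := fun f => f ∘ σ.symm
      invFun := fun f => f ∘ σ
      left_inv := fun f => by funext x; simp
      right_inv := fun f => by funext x; simp
      map_mul' := fun f g => rfl }
  map_one' := by
    ext f x
    rfl
  map_mul' := by
    intro σ τ
    ext f x
    rfl

/-- Right translation action of `G` on `G → B`. -/
def rightTrans (G B : Type) [Group G] (g : G) : (G → B) → (G → B) :=
  fun f x => f (x * g)

/-- The space `Fun_H(G, B)` of `H`-equivariant functions `G → B`. -/
def FunHsub (G : Type) [Group G] (B : Type) [AddCommGroup B] [Module F B]
    (H : Subgroup G) (OB : OperadAlgebraOn F O B) (φ : H →* AlgAutGroup OB) :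
    Submodule F (G → B) where
  carrier := {f | ∀ (h : H) (x : G),
    f ((h : G) * x) = ((φ h : AlgAutGroup OB) : B ≃ₗ[F] B) (f x)}
  add_mem' := by
    intro f g hf hg h x
    simp [hf h x, hg h x]
  zero_mem' := by intro h x; simp
  smul_mem' := by
    intro t f hf h x
    simp [hf h x]

/-- A bundled `C`-algebra (used for existential quantification over algebras). -/
structure OperadAlgBundle (F : Type) [Field F] (O : LinearOperadData F) where
  carrier : Type
  [acg : AddCommGroup carrier]
  [mod : Module F carrier]
  alg : OperadAlgebraOn F O carrier

attribute [instance] OperadAlgBundle.acg OperadAlgBundle.mod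

/-- `(A, ρ)` is modeled by `Fun_H(G, B)` for the pair `(H, φ)`:
there is an injective `G`-equivariant `C`-algebra map of `A` onto the subalgebra
`Fun_H(G, B)` of the pointwise algebra `G → B`, where `B` is simple and `G` acts by
right translation. -/
def IsFunHModel {G : Type} [Group G] (OA : OperadAlgebraOn F O A)
    (ρ : G →* (A ≃ₗ[F] A)) (H : Subgroup G) (Bb : OperadAlgBundle F O)
    (φ : H →* AlgAutGroup Bb.alg) : Prop :=
  IsSimpleAlg Bb.alg ∧
  ∃ OGB : OperadAlgebraOn F O (G → Bb.carrier),
    IsPointwiseAlg Bb.alg OGB ∧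
    ∃ e : A →ₗ[F] (G → Bb.carrier), Function.Injective e ∧
      LinearMap.range e = FunHsub G Bb.carrier H Bb.alg φ ∧
      (∀ (n : ℕ) (c : O.C n) (v : Fin n → A),
        e (OA.α n c v) = OGB.α n c fun k => e (v k)) ∧
      (∀ (g : G) (a : A) (x : G), e (ρ g a) x = e a (x * g))

open Submodule

theorem iSupIndep.isCompl_of_iSup_eq_top {ι α : Type*} [CompleteLattice α] {P : ι → α}
    (hind : iSupIndep P) (hsup : ⨆ i, P i = ⊤) (i : ι) :
    IsCompl (P i) (⨆ (j) (_ : j ≠ i), P j) := by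
  refine ⟨hind i, codisjoint_iff.2 (top_le_iff.1 (hsup ▸ iSup_le fun j => ?_))⟩
  by_cases hj : j = i
  · exact hj ▸ le_sup_left
  · exact le_sup_of_le_right (le_iSup₂_of_le j hj le_rfl)

section Ideals

variable (OA : OperadAlgebraOn F O A)

theorem OperadAlgebraOn.op_apply {n : ℕ} (c : O.C n) (v : Fin n → A) (j : Fin n) (x : A) :
    OA.op c v j x = OA.α n c (Function.update v j x) := rfl

theorem OperadAlgebraOn.op_apply_self {n : ℕ} (c : O.C n) (v : Fin n → A) (j : Fin n) :
    OA.op c v j (v j) = OA.α n c v := by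
  rw [op_apply, Function.update_eq_self]

theorem isIdealPred_iff_op {J : Submodule F A} :
    IsIdealPred OA J ↔
      ∀ (n : ℕ) (c : O.C n) (v : Fin n → A) (j : Fin n), ∀ x ∈ J, OA.op c v j x ∈ J := by
  refine ⟨fun h n c v j x hx => h n c _ j (by simpa using hx), fun h n c v j hv => ?_⟩
  rw [← OA.op_apply_self c v j]
  exact h n c v j _ hv

variable {OA}

theorem IsIdealPred.op_mem {J : Submodule F A} (hJ : IsIdealPred OA J) {n : ℕ} (c : O.C n)
    (v : Fin n → A) (j : Fin n) {x : A} (hx : x ∈ J) : OA.op c v j x ∈ J :=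
  (isIdealPred_iff_op OA).1 hJ n c v j x hx

theorem IsIdealPred.sInf {S : Set (Submodule F A)} (hS : ∀ J ∈ S, IsIdealPred OA J) :
    IsIdealPred OA (sInf S) := by
  intro n c v j hv
  rw [Submodule.mem_sInf] at hv ⊢
  exact fun J hJ => hS J hJ n c v j (hv J hJ)

theorem IsIdealPred.inf {J K : Submodule F A} (hJ : IsIdealPred OA J) (hK : IsIdealPred OA K) :
    IsIdealPred OA (J ⊓ K) :=
  fun n c v j hv => ⟨hJ n c v j hv.1, hK n c v j hv.2⟩

theorem IsIdealPred.iSup {ι : Sort*} {J : ι → Submodule F A} (hJ : ∀ i, IsIdealPred OA (J i)) :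
    IsIdealPred OA (⨆ i, J i) := by
  rw [isIdealPred_iff_op]
  intro n c v j x hx
  have : (⨆ i, J i) ≤ (⨆ i, J i).comap (OA.op c v j) :=
    iSup_le fun i y hy => mem_iSup_of_mem i ((hJ i).op_mem c v j hy)
  exact this hx

theorem isIdealPred_preRad : IsIdealPred OA (preRad OA) :=
  IsIdealPred.sInf fun _ hM => hM.1

theorem IsIdealPred.EA_mem {J : Submodule F A} (hJ : IsIdealPred OA J) {e : Module.End F A}
    (he : e ∈ EA OA) {x : A} (hx : x ∈ J) : e x ∈ J := by
  have : EA OA ≤ J.comap (LinearMap.applyₗ x) :=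
    span_le.2 (by rintro _ ⟨n, -, c, v, j, rfl⟩; exact hJ.op_mem c v j hx)
  exact this he

theorem EA_apply_mem {J : Submodule F A} {x : A}
    (h : ∀ (n : ℕ), 2 ≤ n → ∀ (c : O.C n) (v : Fin n → A) (j : Fin n), OA.op c v j x ∈ J)
    {e : Module.End F A} (he : e ∈ EA OA) : e x ∈ J := by
  have : EA OA ≤ J.comap (LinearMap.applyₗ x) :=
    span_le.2 (by rintro _ ⟨n, hn, c, v, j, rfl⟩; exact h n hn c v j)
  exact this he

theorem op_mem_EA {n : ℕ} (hn : 2 ≤ n) (c : O.C n) (v : Fin n → A) (j : Fin n) :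
    OA.op c v j ∈ EA OA :=
  subset_span ⟨n, hn, c, v, j, rfl⟩

theorem mem_radAlg {x : A} : x ∈ radAlg OA ↔ ∀ e ∈ EA OA, e x ∈ preRad OA := by
  simp [radAlg]

theorem preRad_le_radAlg : preRad OA ≤ radAlg OA :=
  fun _ hx => mem_radAlg.2 fun _ he => isIdealPred_preRad.EA_mem he hx

/-- Operations are well defined modulo an ideal. -/
theorem IsIdealPred.map_sub_map_mem {J : Submodule F A} (hJ : IsIdealPred OA J) {n : ℕ}
    (c : O.C n) {v w : Fin n → A} (h : ∀ k, v k - w k ∈ J) : OA.α n c v - OA.α n c w ∈ J := by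
  have key : ∀ s : Finset (Fin n), OA.α n c (s.piecewise v w) - OA.α n c w ∈ J := by
    intro s
    induction s using Finset.induction_on with
    | empty => simp
    | insert k s hk ih =>
      rw [Finset.piecewise_insert]
      have h1 : OA.α n c (Function.update (s.piecewise v w) k (v k)) -
          OA.α n c (s.piecewise v w) ∈ J := by
        have h2 : OA.α n c (s.piecewise v w) =
            OA.op c (s.piecewise v w) k (w k) := by
          rw [← OA.op_apply_self c _ k, Finset.piecewise_eq_of_notMem _ _ _ hk]
        rw [h2, ← OA.op_apply, ← map_sub]
        exact hJ.op_mem c _ k (h k)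
      have := J.add_mem h1 ih
      rwa [sub_add_sub_cancel] at this
  simpa using key Finset.univ

/-- The kernel of the `E_A`-action is an ideal. -/
theorem isIdealPred_annihilator_EA :
    IsIdealPred OA (⨅ (e : Module.End F A) (_ : e ∈ EA OA), LinearMap.ker e) := by
  intro n d w k hw
  simp only [mem_iInf, LinearMap.mem_ker] at hw ⊢
  intro e he
  rw [← mem_bot F]
  refine EA_apply_mem (fun m hm c v j => ?_) he
  rw [mem_bot, OA.op_apply]
  have hj := j.isLt
  have hk := k.isLt
  let u : Fin (m + n - 1) → A := fun l =>
    if h1 : (l : ℕ) < j then v ⟨l, by omega⟩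
    else if h2 : (l : ℕ) < j + n then w ⟨l - j, by omega⟩
    else v ⟨l + 1 - n, by have := l.isLt; omega⟩
  have hu : OA.α (m + n - 1) (O.comp c d j) u =
      OA.α m c (Function.update v j (OA.α n d w)) := by
    rw [OA.α_comp]
    congr 1
    funext l
    rcases lt_trichotomy (l : ℕ) j with h | h | h
    · have : l ≠ j := fun h' => by simp [h'] at h
      simp [u, h, this]
    · obtain rfl : l = j := Fin.ext h
      simp [u]
    · have h1 : l ≠ j := fun h' => by simp [h'] at h
      have h2 : ¬ (l : ℕ) < j := by omega
      have h3 : ¬ (l : ℕ) = j := by omega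
      have h4 : ¬ (l : ℕ) + n - 1 < j := by omega
      have h5 : ¬ (l : ℕ) + n - 1 < j + n := by omega
      have h6 : (l : ℕ) + n - 1 + 1 - n = l := by omega
      simp [u, h1, h2, h3, h4, h5, h6]
  rw [← hu, ← OA.op_apply_self (O.comp c d j) u ⟨j + k, by omega⟩]
  have : u ⟨j + k, by omega⟩ = w k := by simp [u]
  rw [this]
  exact hw _ (op_mem_EA (by omega) _ _ _)

end Ideals

section Semisimple

variable {OA : OperadAlgebraOn F O A}

theorem IsSimplePiece.eq_zero_of_EA {P : Submodule F A} (hP : IsSimplePiece OA P) {x : A}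
    (hx : x ∈ P) (h : ∀ e ∈ EA OA, e x = 0) : x = 0 := by
  obtain ⟨hI, hmin, n, hn, c, v, hv, hne⟩ := hP
  rcases hmin _ inf_le_left (hI.inf isIdealPred_annihilator_EA) with h0 | h0
  · rw [← mem_bot F, ← h0]
    exact ⟨hx, by simpa using h⟩
  · let j : Fin n := ⟨0, by omega⟩
    have hvj : v j ∈ P := hv j
    rw [← h0] at hvj
    have := (mem_inf.1 hvj).2
    simp only [mem_iInf, LinearMap.mem_ker] at this
    exact absurd (OA.op_apply_self c v j ▸ this _ (op_mem_EA hn c v j)) hne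

theorem IsSimplePiece.ne_bot {P : Submodule F A} (hP : IsSimplePiece OA P) : P ≠ ⊥ := by
  rintro rfl
  obtain ⟨hI, -, n, hn, c, v, hv, hne⟩ := hP
  exact hne ((mem_bot F).1 (hI n c v ⟨0, by omega⟩ (hv _)))

/-- An ideal complementing a simple summand is maximal. -/
theorem IsSimplePiece.isMaxIdeal_of_isCompl {P M : Submodule F A} (hP : IsSimplePiece OA P)
    (hM : IsIdealPred OA M) (h : IsCompl P M) : IsMaxIdeal OA M := by
  refine ⟨hM, fun hT => hP.ne_bot ?_, fun J hJ hlt => ?_⟩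
  · simpa [hT] using h.inf_eq_bot
  · rcases hP.2.1 _ inf_le_left (hP.1.inf hJ) with h0 | h0
    · refine absurd ?_ hlt.ne
      calc M = M ⊔ P ⊓ J := by rw [h0, sup_bot_eq]
        _ = (M ⊔ P) ⊓ J := (sup_inf_assoc_of_le P hlt.le).symm
        _ = J := by rw [sup_comm, h.sup_eq_top, top_inf_eq]
    · rw [inf_eq_left] at h0
      exact top_le_iff.1 (h.sup_eq_top ▸ sup_le h0 hlt.le)

theorem IsSemisimpleAlg.radAlg_eq_bot (h : IsSemisimpleAlg OA) : radAlg OA = ⊥ := by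
  obtain ⟨m, P, hind, hsup, hP⟩ := h
  let M : Fin m → Submodule F A := fun i => ⨆ (j) (_ : j ≠ i), P j
  have hMideal (i) : IsIdealPred OA (M i) :=
    IsIdealPred.iSup fun j => IsIdealPred.iSup fun _ => (hP j).1
  have hcompl (i) : IsCompl (P i) (M i) := hind.isCompl_of_iSup_eq_top hsup i
  have hmax (i) : preRad OA ≤ M i :=
    sInf_le ((hP i).isMaxIdeal_of_isCompl (hMideal i) (hcompl i))
  refine eq_bot_iff.2 fun x hx => (mem_bot F).2 ?_
  rw [mem_radAlg] at hx
  obtain ⟨a, rfl⟩ := (mem_iSup_iff_exists_dfinsupp P x).1 (hsup ▸ mem_top)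
  have hsum : DFinsupp.lsum ℕ (fun i => (P i).subtype) a = ∑ i, (a i : A) := by
    classical
    rw [DFinsupp.lsum_apply_apply, DFinsupp.sumAddHom_apply,
      DFinsupp.sum_eq_sum_fintype _ fun i => map_zero _]
    rfl
  rw [hsum] at hx ⊢
  refine Finset.sum_eq_zero fun i _ => (hP i).eq_zero_of_EA (a i).2 fun e he => ?_
  refine disjoint_def.1 (hcompl i).disjoint _ ((hP i).1.EA_mem he (a i).2) ?_
  have h1 := hmax i (hx e he)
  rw [← Finset.add_sum_erase _ _ (Finset.mem_univ i), map_add] at h1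
  refine (Submodule.add_mem_iff_left _ ((hMideal i).EA_mem he (sum_mem fun j hj => ?_))).1 h1
  exact (le_iSup₂_of_le j (Finset.ne_of_mem_erase hj) le_rfl : P j ≤ M i) (a j).2

end Semisimple

section Hom

variable {OA : OperadAlgebraOn F O A} {B : Type} [AddCommGroup B] [Module F B]
  {OB : OperadAlgebraOn F O B} {f : A →ₗ[F] B}

theorem map_op (hf : ∀ (n : ℕ) (c : O.C n) (v : Fin n → A),
      f (OA.α n c v) = OB.α n c (fun k => f (v k)))
    {n : ℕ} (c : O.C n) (v : Fin n → A) (j : Fin n) (x : A) :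
    f (OA.op c v j x) = OB.op c (f ∘ v) j (f x) := by
  rw [OA.op_apply, OB.op_apply, hf, ← Function.comp_update]
  rfl

theorem exists_op_eq (hs : Function.Surjective f) {n : ℕ} (v : Fin n → B) :
    ∃ w : Fin n → A, f ∘ w = v :=
  ⟨_, funext fun k => Function.surjInv_eq hs (v k)⟩

theorem IsIdealPred.comap {J : Submodule F B} (hJ : IsIdealPred OB J)
    (hf : ∀ (n : ℕ) (c : O.C n) (v : Fin n → A),
      f (OA.α n c v) = OB.α n c (fun k => f (v k))) :
    IsIdealPred OA (J.comap f) := by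
  intro n c v j hv
  rw [mem_comap, hf]
  exact hJ n c _ j hv

theorem IsIdealPred.map {J : Submodule F A} (hJ : IsIdealPred OA J)
    (hs : Function.Surjective f)
    (hf : ∀ (n : ℕ) (c : O.C n) (v : Fin n → A),
      f (OA.α n c v) = OB.α n c (fun k => f (v k))) :
    IsIdealPred OB (J.map f) := by
  rw [isIdealPred_iff_op]
  rintro n c v j _ ⟨x, hx, rfl⟩
  obtain ⟨w, rfl⟩ := exists_op_eq hs v
  rw [← map_op hf]
  exact mem_map_of_mem (hJ.op_mem c w j hx)

theorem preRad_le_comap (hs : Function.Surjective f)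
    (hf : ∀ (n : ℕ) (c : O.C n) (v : Fin n → A),
      f (OA.α n c v) = OB.α n c (fun k => f (v k))) :
    preRad OA ≤ (preRad OB).comap f := by
  intro x hx
  rw [mem_comap, preRad, mem_sInf]
  refine fun M hM => mem_sInf.1 hx (M.comap f) ⟨hM.1.comap hf, fun h => hM.2.1 ?_, ?_⟩
  · rw [← map_comap_eq_of_surjective hs M, h, Submodule.map_top, LinearMap.range_eq_top.2 hs]
  · intro J hJ hlt
    have hker : LinearMap.ker f ≤ J := (LinearMap.ker_le_comap f).trans hlt.le
    have hJmap : (J.map f).comap f = J := comap_map_eq_self hker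
    rw [← hJmap, hM.2.2 _ (hJ.map hs hf) ?_, comap_top]
    rw [← hJmap] at hlt
    exact lt_of_le_of_ne ((comap_le_comap_iff_of_surjective hs).1 hlt.le)
      fun h => hlt.ne (by rw [← h])

theorem radAlg_le_comap (hs : Function.Surjective f)
    (hf : ∀ (n : ℕ) (c : O.C n) (v : Fin n → A),
      f (OA.α n c v) = OB.α n c (fun k => f (v k))) :
    radAlg OA ≤ (radAlg OB).comap f := by
  intro x hx
  rw [mem_comap, mem_radAlg]
  refine fun e he => EA_apply_mem (fun n hn c v j => ?_) he
  obtain ⟨w, rfl⟩ := exists_op_eq hs v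
  rw [← map_op hf]
  exact preRad_le_comap hs hf (mem_radAlg.1 hx _ (op_mem_EA hn c w j))

end Hom

section ModuleTheory

variable {R : Type} [Ring R] [Algebra F R]

/-- If the ideals of `A` are its `R`-submodules, `A` is semisimple over `R`, and `E_A` kills no
nonzero element, then `A` is a semisimple `C`-algebra. -/
theorem isSemisimpleAlg_of_isSemisimpleModule [Module R A] [IsScalarTower F R A]
    [FiniteDimensional F A] [IsSemisimpleModule R A] {OA : OperadAlgebraOn F O A}
    (hR : ∀ J : Submodule F A, IsIdealPred OA J ↔ ∀ (r : R), ∀ x ∈ J, r • x ∈ J)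
    (h : ∀ x : A, (∀ e ∈ EA OA, e x = 0) → x = 0) : IsSemisimpleAlg OA := by
  have hideal (J : Submodule R A) : IsIdealPred OA (J.restrictScalars F) :=
    (hR _).2 fun r x hx => J.smul_mem r hx
  have : IsNoetherian R A := isNoetherian_of_tower F inferInstance
  obtain ⟨s, hind, hsup, hsimple⟩ := IsSemisimpleModule.exists_sSupIndep_sSup_simples_eq_top R A
  have : Finite s := WellFoundedGT.finite_of_sSupIndep hind
  obtain ⟨m, ⟨g⟩⟩ := Finite.exists_equiv_fin s
  let φ := restrictScalarsLatticeHom F R A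
  let P : Fin m → Submodule R A := fun i => (g.symm i : Submodule R A)
  have hPind : iSupIndep P := ((sSupIndep_iff s).1 hind).comp g.symm.injective
  have hPsup : ⨆ i, P i = ⊤ := by
    rw [← hsup, sSup_eq_iSup', ← g.symm.iSup_comp]
  have hcompl (i) : IsCompl (P i) (⨆ (j) (_ : j ≠ i), P j) :=
    hPind.isCompl_of_iSup_eq_top hPsup i
  refine ⟨m, fun i => φ (P i), fun i => ?_, ?_, fun i => ⟨hideal _, fun J hJP hJ => ?_, ?_⟩⟩
  · have := (hPind i).map φ
    simpa only [_root_.map_iSup] using this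
  · rw [← _root_.map_iSup, hPsup, TopHomClass.map_top]
  · let J' : Submodule R A := { J with smul_mem' := fun r x hx => (hR J).1 hJ r x hx }
    have hat : IsAtom (P i) := isSimpleModule_iff_isAtom.1 (hsimple _ (g.symm i).2)
    have hle : J' ≤ P i := hJP
    rcases hat.le_iff.1 hle with h0 | h0
    · exact Or.inl (SetLike.ext fun x => SetLike.ext_iff.1 h0 x)
    · exact Or.inr (SetLike.ext fun x => SetLike.ext_iff.1 h0 x)
  · have hat : IsAtom (P i) := isSimpleModule_iff_isAtom.1 (hsimple _ (g.symm i).2)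
    obtain ⟨x, hx, hx0⟩ := (P i).ne_bot_iff.1 hat.1
    obtain ⟨n, hn, c, v, j, hne⟩ : ∃ n, 2 ≤ n ∧ ∃ (c : O.C n) (v : Fin n → A) (j : Fin n),
        OA.op c v j x ≠ 0 := by
      by_contra! hcon
      exact hx0 (h x fun e he =>
        (mem_bot F).1 (EA_apply_mem (fun n hn c v j => (mem_bot F).2 (hcon n hn c v j)) he))
    have hdec (k) : ∃ p ∈ P i, Function.update v j x k - p ∈ ⨆ (l) (_ : l ≠ i), P l := by
      obtain ⟨p, hp, q, hq, hpq⟩ := mem_sup.1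
        ((hcompl i).sup_eq_top ▸ mem_top : Function.update v j x k ∈ _)
      exact ⟨p, hp, by rw [← hpq, add_sub_cancel_left]; exact hq⟩
    choose p hp hpN using hdec
    refine ⟨n, hn, c, p, hp, fun h0 => hne ?_⟩
    have hmem := (hideal (⨆ (l) (_ : l ≠ i), P l)).map_sub_map_mem c (w := p) hpN
    rw [h0, sub_zero] at hmem
    exact disjoint_def.1 (hcompl i).disjoint _ ((hideal (P i)).op_mem c v j hx) hmem

theorem isSemisimpleAlg_of_radAlg_le_ker [Module R A] [IsScalarTower F R A]
    [FiniteDimensional F A] {B : Type} [AddCommGroup B] [Module F B] [Module R B]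
    [IsScalarTower F R B] [FiniteDimensional F B]
    {OA : OperadAlgebraOn F O A} {OB : OperadAlgebraOn F O B}
    (hA : ∀ J : Submodule F A, IsIdealPred OA J ↔ ∀ (r : R), ∀ x ∈ J, r • x ∈ J)
    (hB : ∀ J : Submodule F B, IsIdealPred OB J ↔ ∀ (r : R), ∀ x ∈ J, r • x ∈ J)
    {f : A →ₗ[R] B} (hs : Function.Surjective f)
    (hf : ∀ (n : ℕ) (c : O.C n) (v : Fin n → A),
      f (OA.α n c v) = OB.α n c (fun k => f (v k)))
    (hrad : radAlg OA ≤ (LinearMap.ker f).restrictScalars F) : IsSemisimpleAlg OB := by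
  have hideal (J : Submodule R A) : IsIdealPred OA (J.restrictScalars F) :=
    (hA _).2 fun r x hx => J.smul_mem r hx
  have : IsArtinian R A := isArtinian_of_tower F inferInstance
  have hjac : (Module.jacobson R A).restrictScalars F ≤ preRad OA := by
    intro x hx
    refine mem_sInf.2 fun M hM => ?_
    let M' : Submodule R A := { M with smul_mem' := fun r x hx => (hA M).1 hM.1 r x hx }
    refine mem_sInf.1 hx M' ⟨fun h0 => hM.2.1 (SetLike.ext fun y => SetLike.ext_iff.1 h0 y), ?_⟩
    intro J hJ
    have := hM.2.2 (J.restrictScalars F) (hideal J) hJ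
    exact SetLike.ext fun y => SetLike.ext_iff.1 this y
  have hker : Module.jacobson R A ≤ LinearMap.ker f := fun x hx =>
    hrad (preRad_le_radAlg (hjac hx))
  have hss : IsSemisimpleModule R (A ⧸ Module.jacobson R A) :=
    (IsArtinian.isSemisimpleModule_iff_jacobson R _).2 (Module.jacobson_quotient_jacobson R A)
  let g : (A ⧸ Module.jacobson R A) →ₗ[R] B := (Module.jacobson R A).liftQ f hker
  have hg : Function.Surjective g := fun y => by
    obtain ⟨x, rfl⟩ := hs y
    exact ⟨mkQ _ x, liftQ_apply _ _ _⟩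
  have : IsSemisimpleModule R B :=
    .congr (g.quotKerEquivOfSurjective hg).symm
  refine isSemisimpleAlg_of_isSemisimpleModule hB fun b hb => ?_
  obtain ⟨a, rfl⟩ := hs b
  obtain ⟨J, hJ⟩ := exists_isCompl (LinearMap.ker g)
  obtain ⟨y, hy, z, hz, hyz⟩ := mem_sup.1
    (hJ.sup_eq_top ▸ mem_top : mkQ (Module.jacobson R A) a ∈ _)
  obtain ⟨a', rfl⟩ := mkQ_surjective _ z
  have hfa : f a = f a' := by
    have := congrArg g hyz
    rw [map_add, LinearMap.mem_ker.1 hy, zero_add] at this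
    exact this.symm
  rw [hfa] at hb ⊢
  refine hrad (mem_radAlg.2 fun e he => EA_apply_mem (fun n hn c v j => hjac ?_) he)
  have h1 : OA.op c v j a' ∈ J.comap (mkQ (Module.jacobson R A)) :=
    (hideal (J.comap (mkQ _))).op_mem c v j hz
  have h2 : f (OA.op c v j a') = 0 := by
    have := map_op (f := f.restrictScalars F) hf c v j a'
    exact this.trans (hb _ (op_mem_EA hn c _ j))
  have h3 : mkQ (Module.jacobson R A) (OA.op c v j a') = 0 :=
    disjoint_def.1 hJ.disjoint _ (LinearMap.mem_ker.2 h2) h1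
  simpa using h3

end ModuleTheory

section FreeAction

/-- Names of the operators generating `R_A`. -/
abbrev OpIndex (O : LinearOperadData F) (A : Type) : Type :=
  Σ n : ℕ, O.C n × (Fin n → A) × Fin n

/-- The action on `B`, through a map `f : A → B`, of the free algebra on the operators of `A`. -/
def freeOpAction {B : Type} [AddCommGroup B] [Module F B] (OB : OperadAlgebraOn F O B)
    (f : A → B) : FreeAlgebra F (OpIndex O A) →ₐ[F] Module.End F B :=
  FreeAlgebra.lift F fun i => OB.op i.2.1 (f ∘ i.2.2.1) i.2.2.2

theorem isIdealPred_iff_freeOpAction {A B : Type} [AddCommGroup B] [Module F B]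
    (OB : OperadAlgebraOn F O B) {f : A → B} (hs : Function.Surjective f) (J : Submodule F B) :
    IsIdealPred OB J ↔ ∀ r, ∀ x ∈ J, freeOpAction OB f r x ∈ J := by
  rw [isIdealPred_iff_op]
  refine ⟨fun h r => ?_, fun h n c v j x hx => ?_⟩
  · induction r using FreeAlgebra.induction with
    | grade0 t => intro x hx; simpa using J.smul_mem t hx
    | grade1 i => intro x hx; simpa [freeOpAction] using h _ _ _ _ x hx
    | mul a b ha hb => intro x hx; simpa using ha _ (hb x hx)
    | add a b ha hb => intro x hx; simpa using J.add_mem (ha x hx) (hb x hx)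
  · have hw : f ∘ (fun k => Function.surjInv hs (v k)) = v :=
      funext fun k => Function.surjInv_eq hs (v k)
    simpa [freeOpAction, hw] using
      h (FreeAlgebra.ι F ⟨n, c, fun k => Function.surjInv hs (v k), j⟩) x hx

theorem map_freeOpAction {OA : OperadAlgebraOn F O A} {B : Type} [AddCommGroup B] [Module F B]
    {OB : OperadAlgebraOn F O B} {f : A →ₗ[F] B}
    (hf : ∀ (n : ℕ) (c : O.C n) (v : Fin n → A),
      f (OA.α n c v) = OB.α n c (fun k => f (v k)))
    (r : FreeAlgebra F (OpIndex O A)) (x : A) :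
    f (freeOpAction OA id r x) = freeOpAction OB f r (f x) := by
  induction r using FreeAlgebra.induction generalizing x with
  | grade0 t => simp
  | grade1 i => simp [freeOpAction, map_op hf]
  | mul a b ha hb => simp [ha, hb]
  | add a b ha hb => simp [ha, hb]

end FreeAction

/-- for an ideal `I ⊆ A`, the quotient `A/I` is a semisimple `C`-algebra
iff `I ⊇ Rad(A)`. -/
theorem quotient_semisimple_iff_radical_le {F : Type} [Field F] {O : LinearOperadData F}
    {A : Type} [AddCommGroup A] [Module F A] [FiniteDimensional F A]
    (OA : OperadAlgebraOn F O A) (I : Submodule F A) (hI : IsIdealPred OA I)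
    (OQ : OperadAlgebraOn F O (A ⧸ I)) (hOQ : IsQuotientAlg OA I OQ) :
    IsSemisimpleAlg OQ ↔ radAlg OA ≤ I := by
  constructor
  · intro h x hx
    have := radAlg_le_comap I.mkQ_surjective hOQ hx
    rw [h.radAlg_eq_bot] at this
    simpa using this
  · intro h
    let R := FreeAlgebra F (OpIndex O A)
    let : Module R A := Module.compHom A (freeOpAction OA id).toRingHom
    let : Module R (A ⧸ I) := Module.compHom (A ⧸ I) (freeOpAction OQ I.mkQ).toRingHom
    have : IsScalarTower F R A :=
      ⟨fun t r x => LinearMap.congr_fun (map_smul (freeOpAction OA id) t r) x⟩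
    have : IsScalarTower F R (A ⧸ I) :=
      ⟨fun t r x => LinearMap.congr_fun (map_smul (freeOpAction OQ I.mkQ) t r) x⟩
    let f : A →ₗ[R] A ⧸ I := { I.mkQ with map_smul' := fun r x => map_freeOpAction hOQ r x }
    refine isSemisimpleAlg_of_radAlg_le_ker (R := R) (f := f)
      (isIdealPred_iff_freeOpAction OA Function.surjective_id)
      (isIdealPred_iff_freeOpAction OQ I.mkQ_surjective) I.mkQ_surjective hOQ
      fun x hx => ?_
    exact (Submodule.Quotient.mk_eq_zero I).2 (h hx)
end

section
/- Let G be a finite group, B a simple C-algebra, and consider two pairs (H, φ) and (H', φ') with H, H' ≤ G and φ : H → Aut(B), φ' : H' → Aut(B) homomorphisms. If Fun_H(G,B) ≅ Fun_{H'}(G,B) as G-equivariant C-algebras, then H' is conjugate to H in G, and after identifying H' with H via this conjugation, φ' is conjugate to φ by an element of Aut(B). -/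
variable {F : Type} [Field F] {O : LinearOperadData F}
variable {A : Type} [AddCommGroup A] [Module F A]

section FunH

variable {G : Type} [Group G] {B : Type} [AddCommGroup B] [Module F B]
  {H : Subgroup G} {OB : OperadAlgebraOn F O B} {φ : H →* AlgAutGroup OB}

theorem funHsub_apply_mul (f : FunHsub G B H OB φ) (h : H) (x : G) :
    (f : G → B) (h * x) = ((φ h : AlgAutGroup OB) : B ≃ₗ[F] B) ((f : G → B) x) :=
  f.2 h x

/-- `Fun_H(G, B)` is closed under the pointwise operations. -/
theorem funHsub_op_mem {n : ℕ} (c : O.C n) (v : Fin n → FunHsub G B H OB φ) :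
    (fun x => OB.α n c fun k => (v k : G → B) x) ∈ FunHsub G B H OB φ := by
  intro h x
  rw [(φ h).2 n c]
  simp only [funHsub_apply_mul]

/-- `Fun_H(G, B)` is stable under right translation. -/
theorem rightTrans_mem_funHsub (f : FunHsub G B H OB φ) (g : G) :
    rightTrans G B g f ∈ FunHsub G B H OB φ := by
  intro h x
  simp only [rightTrans, mul_assoc, funHsub_apply_mul]

/-- There is an element of `Fun_H(G, B)` supported on `Hs` with prescribed value at `s`. -/
theorem exists_funHsub_single (s : G) (b : B) :
    ∃ f : FunHsub G B H OB φ, (f : G → B) s = b ∧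
      ∀ x, x * s⁻¹ ∉ H → (f : G → B) x = 0 := by
  classical
  refine ⟨⟨fun x => if hx : x * s⁻¹ ∈ H then
    ((φ ⟨x * s⁻¹, hx⟩ : AlgAutGroup OB) : B ≃ₗ[F] B) b else 0, ?_⟩, ?_, ?_⟩
  · intro h x
    beta_reduce
    by_cases hx : x * s⁻¹ ∈ H
    · have hhx : (h : G) * x * s⁻¹ ∈ H := by
        rw [mul_assoc]; exact H.mul_mem h.2 hx
      have hmul : (⟨(h : G) * x * s⁻¹, hhx⟩ : H) = h * ⟨x * s⁻¹, hx⟩ :=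
        Subtype.ext (mul_assoc _ _ _)
      rw [dif_pos hhx, dif_pos hx, hmul, map_mul]
      rfl
    · have hhx : (h : G) * x * s⁻¹ ∉ H := by
        rwa [mul_assoc, H.mul_mem_cancel_left h.2]
      rw [dif_neg hhx, dif_neg hx, map_zero]
  · have hs : s * s⁻¹ ∈ H := by simp
    have hone : (⟨s * s⁻¹, hs⟩ : H) = 1 := Subtype.ext (mul_inv_cancel s)
    simp only [dif_pos hs, hone, map_one]
    rfl
  · intro x hx
    exact dif_neg hx

open Classical in
/-- Restriction of an element of `Fun_H(G, B)` to a coset of `H`, extended by zero. -/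
noncomputable def cosetProj (q : Quotient (QuotientGroup.rightRel H)) :
    FunHsub G B H OB φ →ₗ[F] FunHsub G B H OB φ where
  toFun f := ⟨fun x => if (Quotient.mk'' x : Quotient (QuotientGroup.rightRel H)) = q
      then (f : G → B) x else 0, by
    intro h x
    have hq : (Quotient.mk'' ((h : G) * x) : Quotient (QuotientGroup.rightRel H)) =
        Quotient.mk'' x := by
      rw [Quotient.eq'', QuotientGroup.rightRel_apply]
      simp
    simp only [hq]
    split_ifs
    · exact funHsub_apply_mul f h x
    · simp⟩
  map_add' f g := by
    ext x
    by_cases h : (Quotient.mk'' x : Quotient (QuotientGroup.rightRel H)) = q <;> simp [h]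
  map_smul' t f := by
    ext x
    by_cases h : (Quotient.mk'' x : Quotient (QuotientGroup.rightRel H)) = q <;> simp [h]

theorem cosetProj_apply_of_eq {q : Quotient (QuotientGroup.rightRel H)}
    (f : FunHsub G B H OB φ) {x : G} (hx : Quotient.mk'' x = q) :
    (cosetProj q f : G → B) x = (f : G → B) x :=
  if_pos hx

theorem cosetProj_apply_of_ne {q : Quotient (QuotientGroup.rightRel H)}
    (f : FunHsub G B H OB φ) {x : G} (hx : Quotient.mk'' x ≠ q) :
    (cosetProj q f : G → B) x = 0 :=
  if_neg hx

theorem sum_cosetProj [Fintype (Quotient (QuotientGroup.rightRel H))]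
    (f : FunHsub G B H OB φ) : ∑ q, cosetProj q f = f := by
  ext x
  rw [Submodule.coe_sum, Finset.sum_apply,
    Finset.sum_eq_single (Quotient.mk'' x : Quotient (QuotientGroup.rightRel H))]
  · exact cosetProj_apply_of_eq f rfl
  · intro q _ hq
    exact cosetProj_apply_of_ne f hq.symm
  · simp

theorem cosetProj_eq_zero {s : G} {f : FunHsub G B H OB φ} (hf : (f : G → B) s = 0) :
    cosetProj (Quotient.mk'' s) f = 0 := by
  ext x
  by_cases hx : (Quotient.mk'' x : Quotient (QuotientGroup.rightRel H)) = Quotient.mk'' s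
  · rw [cosetProj_apply_of_eq f hx]
    rw [eq_comm, Quotient.eq'', QuotientGroup.rightRel_apply] at hx
    have := funHsub_apply_mul f ⟨x * s⁻¹, hx⟩ s
    rw [hf, map_zero, inv_mul_cancel_right] at this
    simpa using this
  · rw [cosetProj_apply_of_ne f hx]
    rfl

/-- A linear map `Fun_H(G, B) → B` respecting the operad operations. -/
def IsFunHAlgHom (ψ : FunHsub G B H OB φ →ₗ[F] B) : Prop :=
  ∀ (n : ℕ) (c : O.C n) (v : Fin n → FunHsub G B H OB φ) (w : FunHsub G B H OB φ),
    (∀ x, (w : G → B) x = OB.α n c fun k => (v k : G → B) x) →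
      ψ w = OB.α n c fun k => ψ (v k)

/-- The image of a coset summand under a surjective algebra map is an ideal. -/
theorem isIdealPred_range_comp_cosetProj {ψ : FunHsub G B H OB φ →ₗ[F] B}
    (hψ : IsFunHAlgHom ψ) (hsurj : Function.Surjective ψ)
    (q : Quotient (QuotientGroup.rightRel H)) :
    IsIdealPred OB (LinearMap.range (ψ ∘ₗ cosetProj q)) := by
  classical
  rintro n c v j ⟨f, hf⟩
  choose g hg using fun k => hsurj (v k)
  let a := Function.update g j (cosetProj q f)
  have ha : ∀ k, ψ (a k) = v k := by
    intro k
    by_cases hk : k = j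
    · subst hk
      simpa [a] using hf
    · simp [a, hk, hg]
  let w : FunHsub G B H OB φ := ⟨_, funHsub_op_mem c a⟩
  have hw : cosetProj q w = w := by
    ext x
    by_cases hx : Quotient.mk'' x = q
    · exact cosetProj_apply_of_eq w hx
    · rw [cosetProj_apply_of_ne w hx]
      refine ((OB.α n c).map_coord_zero j ?_).symm
      simp only [a, Function.update_self]
      exact cosetProj_apply_of_ne f hx
  refine ⟨w, ?_⟩
  rw [LinearMap.comp_apply, hw, hψ n c a w fun _ => rfl]
  simp only [ha]

/-- A simple algebra has a nonzero product of at least two factors. -/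
theorem IsSimpleAlg.exists_ne_zero (hB : IsSimpleAlg OB) :
    ∃ n : ℕ, 2 ≤ n ∧ ∃ (c : O.C n) (v : Fin n → B), OB.α n c v ≠ 0 := by
  by_contra! hzero
  refine hB.2 (Submodule.span_eq_bot.2 ?_)
  rintro T ⟨n, hn, c, v, j, rfl⟩
  ext b
  exact hzero n hn c _

/-- A surjective algebra map to a simple algebra is nonzero on at most one coset summand. -/
theorem coset_eq_of_comp_cosetProj_ne_zero (hB : IsSimpleAlg OB)
    {ψ : FunHsub G B H OB φ →ₗ[F] B} (hψ : IsFunHAlgHom ψ) (hsurj : Function.Surjective ψ)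
    {p q : Quotient (QuotientGroup.rightRel H)} (hp : ψ ∘ₗ cosetProj p ≠ 0)
    (hq : ψ ∘ₗ cosetProj q ≠ 0) : p = q := by
  classical
  by_contra hpq
  have htop : ∀ r : Quotient (QuotientGroup.rightRel H), ψ ∘ₗ cosetProj r ≠ 0 →
      Function.Surjective (ψ ∘ₗ cosetProj r) := fun r hr =>
    LinearMap.range_eq_top.1 ((hB.1 _ (isIdealPred_range_comp_cosetProj hψ hsurj r)).resolve_left
      fun h => hr (LinearMap.range_eq_bot.1 h))
  obtain ⟨n, hn, c, v, hv⟩ := hB.exists_ne_zero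
  let i : Fin n := ⟨0, by omega⟩
  let j : Fin n := ⟨1, by omega⟩
  have hij : i ≠ j := by simp [i, j]
  choose g hg using fun k => hsurj (v k)
  obtain ⟨f₁, hf₁⟩ := htop p hp (v i)
  obtain ⟨f₂, hf₂⟩ := htop q hq (v j)
  let a := Function.update (Function.update g i (cosetProj p f₁)) j (cosetProj q f₂)
  have hai : a i = cosetProj p f₁ := by simp [a, hij]
  have haj : a j = cosetProj q f₂ := by simp [a]
  have ha : ∀ k, ψ (a k) = v k := by
    intro k
    by_cases hkj : k = j
    · rw [hkj, haj]; exact hf₂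
    by_cases hki : k = i
    · rw [hki, hai]; exact hf₁
    simp [a, hkj, hki, hg]
  have h0 : ψ 0 = OB.α n c fun k => ψ (a k) := by
    refine hψ n c a 0 fun x => ?_
    by_cases hx : Quotient.mk'' x = p
    · refine ((OB.α n c).map_coord_zero j ?_).symm
      rw [haj]
      exact cosetProj_apply_of_ne f₂ (hx ▸ hpq)
    · refine ((OB.α n c).map_coord_zero i ?_).symm
      rw [hai]
      exact cosetProj_apply_of_ne f₁ hx
  simp only [ha, map_zero] at h0
  exact hv h0.symm

/-- Every surjective algebra map `Fun_H(G, B) → B` is an evaluation followed by an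
automorphism of `B`. -/
theorem exists_eq_aut_eval [Finite G] [FiniteDimensional F B] (hB : IsSimpleAlg OB)
    {ψ : FunHsub G B H OB φ →ₗ[F] B} (hψ : IsFunHAlgHom ψ) (hsurj : Function.Surjective ψ) :
    ∃ (s : G) (u : AlgAutGroup OB), ∀ f, ψ f = (u : B ≃ₗ[F] B) ((f : G → B) s) := by
  classical
  have := Fintype.ofFinite (Quotient (QuotientGroup.rightRel H))
  have hψ0 : ψ ≠ 0 := by
    rintro rfl
    obtain ⟨n, -, c, v, hv⟩ := hB.exists_ne_zero
    obtain ⟨f, hf⟩ := hsurj (OB.α n c v)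
    exact hv hf.symm
  obtain ⟨q, hq⟩ : ∃ q, ψ ∘ₗ cosetProj q ≠ 0 := by
    by_contra! hall
    refine hψ0 (LinearMap.ext fun f => ?_)
    rw [← sum_cosetProj f, map_sum]
    exact Finset.sum_eq_zero fun q _ => LinearMap.congr_fun (hall q) f
  obtain ⟨s, rfl⟩ := Quotient.exists_rep q
  have hproj : ∀ f, ψ f = ψ (cosetProj (Quotient.mk'' s) f) := by
    intro f
    conv_lhs => rw [← sum_cosetProj f, map_sum]
    refine Finset.sum_eq_single _ (fun r _ hr => ?_) (by simp)
    by_contra hne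
    exact hr (coset_eq_of_comp_cosetProj_ne_zero hB hψ hsurj
      (fun h => hne (LinearMap.congr_fun h f)) hq)
  let ev : FunHsub G B H OB φ →ₗ[F] B := LinearMap.proj s ∘ₗ Submodule.subtype _
  have hev : Function.Surjective ev := fun b =>
    let ⟨f, hf, _⟩ := exists_funHsub_single s b
    ⟨f, hf⟩
  obtain ⟨σ, hσ⟩ := ev.exists_rightInverse_of_surjective (LinearMap.range_eq_top.2 hev)
  have hfac : ∀ f, ψ f = (ψ ∘ₗ σ) ((f : G → B) s) := by
    intro f
    rw [← sub_eq_zero, LinearMap.comp_apply, ← map_sub, hproj, cosetProj_eq_zero, map_zero]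
    have := LinearMap.congr_fun hσ ((f : G → B) s)
    change (f : G → B) s - ev (σ ((f : G → B) s)) = 0
    rw [sub_eq_zero]
    exact this.symm
  have hwsurj : Function.Surjective (ψ ∘ₗ σ) := fun b =>
    let ⟨f, hf⟩ := hsurj b
    ⟨_, (hfac f).symm.trans hf⟩
  let w : B ≃ₗ[F] B := LinearEquiv.ofBijective (ψ ∘ₗ σ)
    ⟨LinearMap.injective_iff_surjective.2 hwsurj, hwsurj⟩
  refine ⟨s, ⟨w, fun n c v => ?_⟩, hfac⟩
  choose g hg using fun k => hev (v k)
  have hgv : ∀ k, (g k : G → B) s = v k := hg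
  have h := hψ n c g ⟨_, funHsub_op_mem c g⟩ fun _ => rfl
  simp only [hfac, hgv] at h
  exact h

end FunH

/-- if `Fun_H(G,B) ≅ Fun_{H'}(G,B)` as `G`-equivariant `C`-algebras, then
`H'` is conjugate to `H` in `G`, and under this identification `φ'` is conjugate to `φ`
by an element of `Aut(B)`. -/
theorem funH_iso_implies_conjugate {F : Type} [Field F] {O : LinearOperadData F}
    (G : Type) [Group G] [Finite G]
    (B : Type) [AddCommGroup B] [Module F B] [FiniteDimensional F B]
    (OB : OperadAlgebraOn F O B) (hB : IsSimpleAlg OB)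
    (OGB : OperadAlgebraOn F O (G → B)) (hOGB : IsPointwiseAlg OB OGB)
    (H H' : Subgroup G) (φ : H →* AlgAutGroup OB) (φ' : H' →* AlgAutGroup OB)
    (e : ↥(FunHsub G B H OB φ) ≃ₗ[F] ↥(FunHsub G B H' OB φ'))
    (healg : ∀ (n : ℕ) (c : O.C n) (v : Fin n → ↥(FunHsub G B H OB φ))
      (w : ↥(FunHsub G B H OB φ)),
      (w : G → B) = OGB.α n c (fun k => (v k : G → B)) →
      (e w : G → B) = OGB.α n c (fun k => (e (v k) : G → B)))
    (hequiv : ∀ (g : G) (y z : ↥(FunHsub G B H OB φ)),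
      (z : G → B) = rightTrans G B g (y : G → B) →
      (e z : G → B) = rightTrans G B g (e y : G → B)) :
    ∃ s : G, (∀ x, x ∈ H' ↔ s * x * s⁻¹ ∈ H) ∧
      ∃ u : AlgAutGroup OB, ∀ (x : G) (hx' : x ∈ H') (hx : s * x * s⁻¹ ∈ H),
        φ' ⟨x, hx'⟩ = u⁻¹ * φ ⟨s * x * s⁻¹, hx⟩ * u := by
  let ψ : FunHsub G B H OB φ →ₗ[F] B :=
    LinearMap.proj 1 ∘ₗ Submodule.subtype _ ∘ₗ e.toLinearMap
  have hψ : IsFunHAlgHom ψ := by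
    intro n c v w hw
    have h := healg n c v w (funext fun x => (hw x).trans (hOGB n c _ x).symm)
    exact (congrFun h 1).trans (hOGB n c _ 1)
  have hsurj : Function.Surjective ψ := by
    intro b
    obtain ⟨f', hf', -⟩ := exists_funHsub_single (φ := φ') 1 b
    exact ⟨e.symm f', by simpa [ψ] using hf'⟩
  obtain ⟨s, w, hw⟩ := exists_eq_aut_eval hB hψ hsurj
  have hval : ∀ f g, (e f : G → B) g = (w : B ≃ₗ[F] B) ((f : G → B) (s * g)) := by
    intro f g
    have h := congrFun (hequiv g f ⟨_, rightTrans_mem_funHsub f g⟩ rfl) 1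
    rw [rightTrans, one_mul] at h
    exact h.symm.trans (hw _)
  have hval' : ∀ (f : FunHsub G B H OB φ) (x : G) (hx : x ∈ H'), (w : B ≃ₗ[F] B) ((f : G → B) (s * x)) =
      ((φ' ⟨x, hx⟩ : AlgAutGroup OB) : B ≃ₗ[F] B) ((w : B ≃ₗ[F] B) ((f : G → B) s)) := by
    intro f x hx
    have h := funHsub_apply_mul (e f) ⟨x, hx⟩ 1
    rwa [hval, hval, mul_one, mul_one] at h
  have hconj : ∀ (f : FunHsub G B H OB φ) (x : G) (hx : s * x * s⁻¹ ∈ H), (f : G → B) (s * x) =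
      ((φ ⟨s * x * s⁻¹, hx⟩ : AlgAutGroup OB) : B ≃ₗ[F] B) ((f : G → B) s) := by
    intro f x hx
    have h := funHsub_apply_mul f ⟨s * x * s⁻¹, hx⟩ s
    rwa [inv_mul_cancel_right] at h
  obtain ⟨b, hb⟩ : ∃ b : B, b ≠ 0 :=
    let ⟨n, _, c, v, hv⟩ := hB.exists_ne_zero
    ⟨_, hv⟩
  refine ⟨s, fun x => ⟨fun hx => ?_, fun hx => ?_⟩, w⁻¹, fun x hx' hx => ?_⟩
  · by_contra hn
    obtain ⟨f, hfs, hf⟩ := exists_funHsub_single (φ := φ) s b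
    have h := hval' f x hx
    rw [hf _ hn, hfs, map_zero, eq_comm, LinearEquiv.map_eq_zero_iff,
      LinearEquiv.map_eq_zero_iff] at h
    exact hb h
  · by_contra hn
    obtain ⟨f', hfs, hf⟩ := exists_funHsub_single (φ := φ') 1 b
    obtain ⟨f, rfl⟩ := e.surjective f'
    have h := hf x (by simpa using hn)
    rw [hval, hconj f x hx, LinearEquiv.map_eq_zero_iff, LinearEquiv.map_eq_zero_iff] at h
    rw [hval, mul_one, h, map_zero] at hfs
    exact hb hfs.symm
  · rw [inv_inv, eq_mul_inv_iff_mul_eq]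
    refine Subtype.ext (LinearEquiv.ext fun y => ?_)
    obtain ⟨f, hfs, -⟩ := exists_funHsub_single (φ := φ) s y
    have h := hval' f x hx'
    rw [hconj f x hx, hfs] at h
    exact h.symm
end
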